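/- Let S be a rational set in the plane containing the two points (0, 0) and (1, 0). Then there exists a squarefree positive integer k such that every point of S has the form (r₁, r₂·√k) with r₁, r₂ ∈ ℚ. -/

import Mathlib

theorem EuclideanSpace.dist_sq_fin_two (p q : EuclideanSpace ℝ (Fin 2)) :
    dist p q ^ 2 = (p 0 - q 0) ^ 2 + (p 1 - q 1) ^ 2 := by
  rw [EuclideanSpace.dist_eq, Real.sq_sqrt (by positivity)]
  simp [Fin.sum_univ_two, Real.dist_eq, sq_abs]

/-- Every positive rational is a rational square times a squarefree positive integer. -/
theorem Rat.exists_sq_mul_squarefree_of_pos {a : ℚ} (ha : 0 < a) :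
    ∃ (k : ℕ) (c : ℚ), 0 < k ∧ Squarefree k ∧ a = c ^ 2 * k := by
  have hnum : 0 < a.num := Rat.num_pos.mpr ha
  obtain ⟨k, b, hk, -, hkb, hsq⟩ :=
    Nat.sq_mul_squarefree_of_pos (Nat.mul_pos (Int.natAbs_pos.mpr hnum.ne') a.den_pos)
  refine ⟨k, b / a.den, hk, hsq, ?_⟩
  have hden : (a.den : ℚ) ≠ 0 := by exact_mod_cast a.den_nz
  have hcast : ((a.num.natAbs : ℕ) : ℚ) = a.num := by
    rw [Nat.cast_natAbs, abs_of_pos hnum]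
  have hmul : (b : ℚ) ^ 2 * k = a.num * a.den := by
    rw [← hcast]
    exact_mod_cast hkb
  rw [div_pow, div_mul_eq_mul_div, hmul]
  nth_rewrite 1 [← Rat.num_div_den a]
  field_simp

/-- A nonzero real with rational square is a rational multiple of the square root of a squarefree
positive integer. -/
theorem Real.exists_eq_mul_sqrt_squarefree {y : ℝ} (hy : y ≠ 0) {a : ℚ} (ha : y ^ 2 = a) :
    ∃ (k : ℕ) (c : ℚ), 0 < k ∧ Squarefree k ∧ y = c * √(k : ℝ) := by
  have hpos : 0 < a := by
    have : (0 : ℝ) < a := ha ▸ by positivity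
    exact_mod_cast this
  obtain ⟨k, c, hk, hsq, hc⟩ := Rat.exists_sq_mul_squarefree_of_pos hpos
  have h : y ^ 2 = (c * √(k : ℝ)) ^ 2 := by
    rw [ha, mul_pow, Real.sq_sqrt (by positivity), hc]
    push_cast
    rfl
  rcases sq_eq_sq_iff_eq_or_eq_neg.mp h with h | h
  · exact ⟨k, c, hk, hsq, h⟩
  · exact ⟨k, -c, hk, hsq, by rw [h]; push_cast; ring⟩

/-- If `S` is a rational set in the plane containing `(0,0)` and `(1,0)`, then
there is a squarefree positive integer `k` such that every point of `S` has the
form `(r₁, r₂·√k)` with `r₁, r₂ ∈ ℚ`. -/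
theorem rationalSet_coords (S : Set (EuclideanSpace ℝ (Fin 2)))
    (hS : ∀ p ∈ S, ∀ q ∈ S, ∃ d : ℚ, dist p q = (d : ℝ))
    (h0 : (!₂[0, 0] : EuclideanSpace ℝ (Fin 2)) ∈ S)
    (h1 : (!₂[1, 0] : EuclideanSpace ℝ (Fin 2)) ∈ S) :
    ∃ k : ℕ, 0 < k ∧ Squarefree k ∧
      ∀ p ∈ S, ∃ r₁ r₂ : ℚ,
        p = (!₂[(r₁ : ℝ), (r₂ : ℝ) * Real.sqrt (k : ℝ)] : EuclideanSpace ℝ (Fin 2)) := by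
  have hdist : ∀ p ∈ S, ∀ q ∈ S, ∃ d : ℚ, (p 0 - q 0) ^ 2 + (p 1 - q 1) ^ 2 = (d : ℝ) := by
    intro p hp q hq
    obtain ⟨d, hd⟩ := hS p hp q hq
    exact ⟨d ^ 2, by rw [← EuclideanSpace.dist_sq_fin_two, hd]; push_cast; rfl⟩
  have hfst : ∀ p ∈ S, ∃ r : ℚ, p 0 = r := by
    intro p hp
    obtain ⟨d, hd⟩ := hdist p hp _ h0
    obtain ⟨e, he⟩ := hdist p hp _ h1
    simp at hd he
    exact ⟨(d - e + 1) / 2, by push_cast; linarith⟩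
  have hsnd_sq : ∀ p ∈ S, ∃ a : ℚ, p 1 ^ 2 = a := by
    intro p hp
    obtain ⟨d, hd⟩ := hdist p hp _ h0
    obtain ⟨r, hr⟩ := hfst p hp
    simp [hr] at hd
    exact ⟨d - r ^ 2, by push_cast; linarith⟩
  have hsnd_mul : ∀ p ∈ S, ∀ q ∈ S, ∃ t : ℚ, p 1 * q 1 = t := by
    intro p hp q hq
    obtain ⟨d, hd⟩ := hdist p hp q hq
    obtain ⟨r, hr⟩ := hfst p hp
    obtain ⟨s, hs⟩ := hfst q hq
    obtain ⟨a, ha⟩ := hsnd_sq p hp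
    obtain ⟨b, hb⟩ := hsnd_sq q hq
    rw [hr, hs] at hd
    exact ⟨((r - s) ^ 2 + a + b - d) / 2, by push_cast; linarith⟩
  suffices h : ∃ k : ℕ, 0 < k ∧ Squarefree k ∧ ∀ p ∈ S, ∃ r : ℚ, p 1 = r * √(k : ℝ) by
    obtain ⟨k, hk, hsq, h⟩ := h
    refine ⟨k, hk, hsq, fun p hp => ?_⟩
    obtain ⟨r₁, hr₁⟩ := hfst p hp
    obtain ⟨r₂, hr₂⟩ := h p hp
    refine ⟨r₁, r₂, ?_⟩
    ext i
    fin_cases i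
    · simpa using hr₁
    · simpa using hr₂
  by_cases hline : ∀ p ∈ S, p 1 = 0
  · exact ⟨1, one_pos, squarefree_one, fun p hp => ⟨0, by simp [hline p hp]⟩⟩
  push Not at hline
  obtain ⟨q, hq, hq0⟩ := hline
  obtain ⟨a, ha⟩ := hsnd_sq q hq
  obtain ⟨k, c, hk, hsq, hc⟩ := Real.exists_eq_mul_sqrt_squarefree hq0 ha
  refine ⟨k, hk, hsq, fun p hp => ?_⟩
  obtain ⟨t, ht⟩ := hsnd_mul p hp q hq
  have ha0 : (a : ℝ) ≠ 0 := ha ▸ pow_ne_zero 2 hq0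
  refine ⟨t * c / a, mul_right_cancel₀ ha0 ?_⟩
  push_cast
  calc p 1 * a = (p 1 * q 1) * q 1 := by rw [← ha]; ring
    _ = t * (c * √(k : ℝ)) := by rw [ht, hc]
    _ = t * c / a * √(k : ℝ) * a := by field_simp
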